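/- Let p be an odd prime, f : ℤ_p → ℤ_p continuous, s ∈ ℤ_p, and n ∈ ℕ. On the open set U = {λ ∈ ℚ_p : ‖λ‖_p > 1}, the function λ ↦ ζ_{p,E}^f(s,λ) is n times differentiable, and for every λ ∈ U its n-th derivative equals (−1)^n·(s−1)_n·ω_v(λ)^{−n}·ζ_{p,E}^f(s+n,λ), where (a)_n := a(a+1)⋯(a+n−1) is the Pochhammer symbol. -/

import Mathlib

open Filter Topology

namespace PZeta

variable (p : ℕ) [Fact p.Prime]

/-- The `N`-th partial sum defining the fermionic integral
`∫_{ℤ_p} g dμ₋₁ = lim_N Σ_{a=0}^{p^N-1} (-1)^a g(a)`. -/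
noncomputable def fermSum (g : ℤ_[p] → ℚ_[p]) (N : ℕ) : ℚ_[p] :=
  ∑ a ∈ Finset.range (p ^ N), (-1 : ℚ_[p]) ^ a * g (a : ℤ_[p])

/-- The `N`-th partial sum defining the Volkenborn integral
`∫_{ℤ_p} g da = lim_N p^{-N} Σ_{a=0}^{p^N-1} g(a)`. -/
noncomputable def volkSum (g : ℤ_[p] → ℚ_[p]) (N : ℕ) : ℚ_[p] :=
  ((p : ℚ_[p]) ^ N)⁻¹ * ∑ a ∈ Finset.range (p ^ N), g (a : ℤ_[p])

/-- The unit part `x·p^{-v_p(x)}` of a nonzero `p`-adic number. -/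
noncomputable def unitPart (x : ℚ_[p]) : ℚ_[p] := x * (p : ℚ_[p]) ^ (-x.valuation)

/-- The Teichmüller representative of a `p`-adic unit, `lim_n x^{p^n}`. -/
noncomputable def teich (x : ℚ_[p]) : ℚ_[p] :=
  limUnder atTop fun n : ℕ => x ^ p ^ n

/-- The projection `⟨x⟩ ∈ 1 + pℤ_p`, via `x = p^{v_p(x)}·ζ·⟨x⟩`. -/
noncomputable def angle (x : ℚ_[p]) : ℚ_[p] := unitPart p x / teich p (unitPart p x)

/-- `ω_v(x) := x / ⟨x⟩ = p^{v_p(x)}·ζ`. -/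
noncomputable def omegaV (x : ℚ_[p]) : ℚ_[p] := x / angle p x

/-- The generalized binomial coefficient `C(t,n) = t(t-1)⋯(t-n+1)/n!`. -/
noncomputable def gbinom (t : ℚ_[p]) (n : ℕ) : ℚ_[p] :=
  (∏ i ∈ Finset.range n, (t - (i : ℚ_[p]))) / (n.factorial : ℚ_[p])

/-- The power `y^t` defined by the binomial series `Σ_n C(t,n)(y-1)^n`
(used for `y ∈ 1 + pℤ_p` and `t ∈ ℤ_p`). -/
noncomputable def bpow (y t : ℚ_[p]) : ℚ_[p] := ∑' n : ℕ, gbinom p t n * (y - 1) ^ n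

/-- The Iwasawa `p`-adic logarithm: `log_p x = Σ_{n≥1} (-1)^{n+1}(⟨x⟩-1)^n/n`
(one has `log_p p = 0` and `log_p ζ = 0` for roots of unity of order prime to `p`). -/
noncomputable def padicLog (x : ℚ_[p]) : ℚ_[p] :=
  ∑' n : ℕ, (-1 : ℚ_[p]) ^ n * (angle p x - 1) ^ (n + 1) / ((n : ℚ_[p]) + 1)

/-- The power `y^t` defined by the exponential series `Σ_n (t·log_p y)^n/n!`
(used for `y ∈ 1 + pℤ_p` and `‖t‖ < p^{(p-2)/(p-1)}`). -/
noncomputable def epow (y t : ℚ_[p]) : ℚ_[p] :=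
  ∑' n : ℕ, (t * padicLog p y) ^ n / (n.factorial : ℚ_[p])

/-- `f : ℤ_p → ℤ_p` is everywhere analytic with integral coefficients:
`f(x) = Σ_k c_k x^k` with `‖c_k‖ ≤ 1`, `c_k → 0`. -/
def EverywhereAnalytic (f : ℤ_[p] → ℤ_[p]) : Prop :=
  ∃ c : ℕ → ℚ_[p], (∀ k, ‖c k‖ ≤ 1) ∧ Tendsto c atTop (𝓝 0) ∧
    ∀ x : ℤ_[p], (f x : ℚ_[p]) = ∑' k : ℕ, c k * (x : ℚ_[p]) ^ k

/-- The `p`-adic Hurwitz-type Euler zeta function w.r.t. `f`: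
`ζ_{p,E}^f(s,λ) = ∫_{ℤ_p} ⟨λ+f(a)⟩^{1-s} dμ₋₁(a)`. -/
noncomputable def zetaE (f : ℤ_[p] → ℤ_[p]) (s : ℤ_[p]) (lam : ℚ_[p]) : ℚ_[p] :=
  limUnder atTop
    (fermSum p fun a => bpow p (angle p (lam + (f a : ℚ_[p]))) (1 - (s : ℚ_[p])))

/-- The `p`-adic Hurwitz zeta function w.r.t. `f`:
`ζ_p^f(s,λ) = (s-1)⁻¹ ∫_{ℤ_p} ⟨λ+f(a)⟩^{1-s} da`. -/
noncomputable def zetaH (f : ℤ_[p] → ℤ_[p]) (s : ℤ_[p]) (lam : ℚ_[p]) : ℚ_[p] :=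
  ((s : ℚ_[p]) - 1)⁻¹ *
    limUnder atTop
      (volkSum p fun a => bpow p (angle p (lam + (f a : ℚ_[p]))) (1 - (s : ℚ_[p])))

end PZeta

open PZeta

namespace PZeta

section Binomial

variable (p : ℕ) [Fact p.Prime]

lemma gbinom_eq_choose (t : ℤ_[p]) (n : ℕ) :
    gbinom p (t : ℚ_[p]) n = ((Ring.choose t n : ℤ_[p]) : ℚ_[p]) := by
  have h := Ring.descPochhammer_eq_factorial_smul_choose t n
  rw [← Polynomial.aeval_eq_smeval, ← Polynomial.eval_map_algebraMap, descPochhammer_map,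
    descPochhammer_eval_eq_prod_range, nsmul_eq_mul] at h
  have h' : ∏ i ∈ Finset.range n, ((t : ℚ_[p]) - (i : ℚ_[p])) =
      (n.factorial : ℚ_[p]) * ((Ring.choose t n : ℤ_[p]) : ℚ_[p]) := by
    have h' := congrArg PadicInt.Coe.ringHom h
    simp only [map_prod, map_mul, map_sub, map_natCast] at h'
    exact h'
  rw [gbinom, h', mul_div_cancel_left₀]
  exact_mod_cast n.factorial_ne_zero

lemma norm_gbinom_le_one (t : ℤ_[p]) (n : ℕ) : ‖gbinom p (t : ℚ_[p]) n‖ ≤ 1 := by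
  rw [gbinom_eq_choose]
  exact PadicInt.norm_le_one _

lemma gbinom_succ_mul (t : ℚ_[p]) (n : ℕ) :
    gbinom p t (n + 1) * ((n + 1 : ℕ) : ℚ_[p]) = t * gbinom p (t - 1) n := by
  have h1 : (n.factorial : ℚ_[p]) ≠ 0 := by exact_mod_cast n.factorial_ne_zero
  have h2 : ((n + 1 : ℕ) : ℚ_[p]) ≠ 0 := by exact_mod_cast n.succ_ne_zero
  have h3 : ∏ i ∈ Finset.range n, (t - ((i + 1 : ℕ) : ℚ_[p])) =
      ∏ i ∈ Finset.range n, (t - 1 - (i : ℚ_[p])) :=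
    Finset.prod_congr rfl fun i _ => by push_cast; ring
  rw [gbinom, gbinom, Finset.prod_range_succ', h3, Nat.factorial_succ, Nat.cast_mul]
  field_simp
  simp [mul_comm]

lemma summable_gbinom (t : ℤ_[p]) {z : ℚ_[p]} (hz : ‖z‖ < 1) :
    Summable fun n => gbinom p (t : ℚ_[p]) n * z ^ n := by
  refine Summable.of_norm_bounded (summable_geometric_of_lt_one (norm_nonneg z) hz) fun n => ?_
  rw [norm_mul, norm_pow]
  exact mul_le_of_le_one_left (by positivity) (norm_gbinom_le_one p t n)

lemma norm_bpow_le_one (t : ℤ_[p]) {y : ℚ_[p]} (hy : ‖y - 1‖ < 1) : ‖bpow p y t‖ ≤ 1 := by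
  refine IsUltrametricDist.norm_tsum_le_of_forall_le_of_nonneg zero_le_one fun n => ?_
  rw [norm_mul, norm_pow]
  exact mul_le_one₀ (norm_gbinom_le_one p t n) (by positivity)
    (pow_le_one₀ (norm_nonneg _) hy.le)

/-- The termwise derivative of the binomial series for `y ^ t` sums to `t y ^ (t - 1)`. -/
lemma hasSum_deriv_bpow (t : ℤ_[p]) {y : ℚ_[p]} (hy : ‖y - 1‖ < 1) :
    HasSum (fun n : ℕ => gbinom p (t : ℚ_[p]) n * (n * (y - 1) ^ (n - 1)))
      ((t : ℚ_[p]) * bpow p y ((t : ℚ_[p]) - 1)) := by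
  rw [← hasSum_nat_add_iff' 1]
  have h := ((summable_gbinom p (t - 1) hy).hasSum).mul_left (t : ℚ_[p])
  push_cast at h
  simpa only [Finset.sum_range_one, Nat.cast_zero, zero_mul, mul_zero, sub_zero,
    Nat.add_sub_cancel, ← mul_assoc, gbinom_succ_mul, bpow] using h

lemma norm_add_pow_sub_le {z k : ℚ_[p]} (hz : ‖z‖ ≤ 1) (hk : ‖k‖ ≤ 1) (n : ℕ) :
    ‖(z + k) ^ n - z ^ n - k * (n * z ^ (n - 1))‖ ≤ ‖k‖ ^ 2 := by
  obtain ⟨z, rfl⟩ : ∃ w : ℤ_[p], (w : ℚ_[p]) = z := ⟨⟨z, hz⟩, rfl⟩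
  obtain ⟨k, rfl⟩ : ∃ w : ℤ_[p], (w : ℚ_[p]) = k := ⟨⟨k, hk⟩, rfl⟩
  obtain ⟨c, hc⟩ := Polynomial.powAddExpansion z k n
  have h' : ((z : ℚ_[p]) + k) ^ n - (z : ℚ_[p]) ^ n - k * (n * (z : ℚ_[p]) ^ (n - 1)) =
      (c : ℚ_[p]) * (k : ℚ_[p]) ^ 2 := by
    have h : ((z : ℚ_[p]) + k) ^ n = z ^ n + n * z ^ (n - 1) * k + c * k ^ 2 := by
      have h := congrArg PadicInt.Coe.ringHom hc
      simp only [map_add, map_mul, map_pow, map_natCast] at h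
      exact h
    rw [h]
    ring
  rw [h', norm_mul, norm_pow]
  exact mul_le_of_le_one_left (by positivity) c.norm_le_one

/-- First-order Taylor estimate for `y ↦ y ^ t`, uniform on `1 + pℤ_p`. -/
lemma norm_bpow_add_sub_le (t : ℤ_[p]) {y k : ℚ_[p]} (hy : ‖y - 1‖ < 1) (hk : ‖k‖ < 1) :
    ‖bpow p (y + k) t - bpow p y t - k * (t * bpow p y ((t : ℚ_[p]) - 1))‖ ≤ ‖k‖ ^ 2 := by
  have hyk : ‖y + k - 1‖ < 1 := by
    rw [show y + k - 1 = y - 1 + k by ring]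
    exact (Padic.nonarchimedean _ _).trans_lt (max_lt hy hk)
  have h := ((summable_gbinom p t hyk).hasSum.sub (summable_gbinom p t hy).hasSum).sub
    ((hasSum_deriv_bpow p t hy).mul_left k)
  rw [bpow, bpow, ← h.tsum_eq]
  refine IsUltrametricDist.norm_tsum_le_of_forall_le_of_nonneg (by positivity) fun n => ?_
  have e : gbinom p (t : ℚ_[p]) n * (y + k - 1) ^ n - gbinom p (t : ℚ_[p]) n * (y - 1) ^ n -
      k * (gbinom p (t : ℚ_[p]) n * (n * (y - 1) ^ (n - 1))) =
      gbinom p (t : ℚ_[p]) n * ((y - 1 + k) ^ n - (y - 1) ^ n - k * (n * (y - 1) ^ (n - 1))) := by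
    rw [show y + k - 1 = y - 1 + k by ring]; ring
  rw [e, norm_mul]
  exact (mul_le_of_le_one_left (norm_nonneg _) (norm_gbinom_le_one p t n)).trans
    (norm_add_pow_sub_le p hy.le hk.le n)

lemma norm_bpow_add_sub_bpow_le (t : ℤ_[p]) {y k : ℚ_[p]} (hy : ‖y - 1‖ < 1) (hk : ‖k‖ < 1) :
    ‖bpow p (y + k) t - bpow p y t‖ ≤ ‖k‖ := by
  have h1 := norm_bpow_add_sub_le p t hy hk
  have h2 := norm_bpow_le_one p (t - 1) hy
  push_cast at h2
  rw [← sub_add_cancel (bpow p (y + k) t - bpow p y t) (k * (t * bpow p y ((t : ℚ_[p]) - 1)))]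
  refine (Padic.nonarchimedean _ _).trans (max_le (h1.trans ?_) ?_)
  · nlinarith [norm_nonneg k]
  · rw [norm_mul, norm_mul]
    exact mul_le_of_le_one_right (norm_nonneg _) (mul_le_one₀ t.norm_le_one (norm_nonneg _) h2)

lemma continuousAt_bpow (t : ℤ_[p]) {y : ℚ_[p]} (hy : ‖y - 1‖ < 1) :
    ContinuousAt (fun x => bpow p x t) y := by
  rw [Metric.continuousAt_iff]
  intro ε hε
  refine ⟨min ε 1, lt_min hε one_pos, fun {x} hx => ?_⟩
  rw [dist_eq_norm] at hx ⊢
  have h := norm_bpow_add_sub_bpow_le p t hy (hx.trans_le (min_le_right _ _))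
  rw [add_sub_cancel] at h
  exact h.trans_lt (hx.trans_le (min_le_left _ _))

end Binomial

section Fermionic

variable (p : ℕ) [Fact p.Prime]

lemma norm_fermSum_le {g : ℤ_[p] → ℚ_[p]} {C : ℝ} (hC : 0 ≤ C) (h : ∀ a, ‖g a‖ ≤ C) (N : ℕ) :
    ‖fermSum p g N‖ ≤ C := by
  refine IsUltrametricDist.norm_sum_le_of_forall_le_of_nonneg hC fun a _ => ?_
  simpa using h a

lemma fermSum_succ_sub (hp : Odd p) (g : ℤ_[p] → ℚ_[p]) (N : ℕ) :
    fermSum p g (N + 1) - fermSum p g N =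
      ∑ j ∈ Finset.range p, ∑ a ∈ Finset.range (p ^ N), (-1 : ℚ_[p]) ^ j * (-1) ^ a *
        (g ((a : ℤ_[p]) + j * p ^ N) - g a) := by
  have h1 : fermSum p g (N + 1) = ∑ j ∈ Finset.range p, ∑ a ∈ Finset.range (p ^ N),
      (-1 : ℚ_[p]) ^ j * (-1) ^ a * g ((a : ℤ_[p]) + j * p ^ N) := by
    have key (m : ℕ) (F : ℕ → ℚ_[p]) : ∑ a ∈ Finset.range (m * p ^ N), F a =
        ∑ j ∈ Finset.range m, ∑ a ∈ Finset.range (p ^ N), F (j * p ^ N + a) := by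
      induction m with
      | zero => simp
      | succ m ih => rw [Nat.succ_mul, Finset.sum_range_add, ih, Finset.sum_range_succ]
    rw [fermSum, pow_succ', key]
    refine Finset.sum_congr rfl fun j _ => Finset.sum_congr rfl fun a _ => ?_
    rw [pow_add, mul_comm j, pow_mul, hp.pow.neg_one_pow]
    push_cast
    rw [add_comm (a : ℤ_[p]), mul_comm (j : ℤ_[p])]
  have h2 : ∑ j ∈ Finset.range p, (-1 : ℚ_[p]) ^ j = 1 := by
    rw [neg_one_geom_sum, if_neg (by simpa using hp)]
  rw [h1]
  simp only [mul_sub, Finset.sum_sub_distrib, mul_assoc, ← Finset.mul_sum]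
  rw [← Finset.sum_mul, h2, one_mul, fermSum]

lemma exists_tendsto_fermSum (hp : Odd p) {g : ℤ_[p] → ℚ_[p]} (hg : Continuous g) :
    ∃ L, Tendsto (fermSum p g) atTop (𝓝 L) := by
  refine cauchySeq_tendsto_of_complete ?_
  refine NonarchimedeanAddGroup.cauchySeq_of_tendsto_sub_nhds_zero ?_
  rw [Metric.tendsto_atTop]
  intro ε hε
  obtain ⟨δ, hδ, H⟩ := Metric.uniformContinuous_iff.1
    (CompactSpace.uniformContinuous_of_continuous hg) (ε / 2) (half_pos hε)
  obtain ⟨M, hM⟩ := PadicInt.exists_pow_neg_lt p hδ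
  refine ⟨M, fun N hN => ?_⟩
  rw [dist_zero_right, fermSum_succ_sub p hp]
  refine lt_of_le_of_lt ?_ (half_lt_self hε)
  refine IsUltrametricDist.norm_sum_le_of_forall_le_of_nonneg (half_pos hε).le fun j _ => ?_
  refine IsUltrametricDist.norm_sum_le_of_forall_le_of_nonneg (half_pos hε).le fun a _ => ?_
  rw [norm_mul, norm_mul, norm_pow, norm_pow, norm_neg, norm_one, one_pow, one_pow, one_mul,
    one_mul, ← dist_eq_norm]
  refine (H ?_).le
  rw [dist_eq_norm, add_sub_cancel_left, norm_mul]
  refine lt_of_le_of_lt (mul_le_of_le_one_left (norm_nonneg _) (PadicInt.norm_le_one _)) ?_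
  rw [PadicInt.norm_p_pow]
  refine lt_of_le_of_lt ?_ hM
  exact zpow_le_zpow_right₀ (by exact_mod_cast (Fact.out : p.Prime).one_le) (by omega)

end Fermionic

section Angle

variable (p : ℕ) [Fact p.Prime]

lemma norm_eq_of_norm_sub_lt {x y : ℚ_[p]} (h : ‖x - y‖ < ‖y‖) : ‖x‖ = ‖y‖ := by
  rw [← sub_add_cancel x y, Padic.add_eq_max_of_ne h.ne, max_eq_right h.le]

lemma norm_unitPart {x : ℚ_[p]} (hx : x ≠ 0) : ‖unitPart p x‖ = 1 := by
  have h0 : (p : ℝ) ≠ 0 := by exact_mod_cast (Fact.out : p.Prime).ne_zero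
  rw [unitPart, norm_mul, Padic.norm_p_zpow, Padic.norm_eq_zpow_neg_valuation hx, neg_neg,
    ← zpow_add₀ h0, neg_add_cancel, zpow_zero]

lemma norm_pow_pow_sub_le {u v : ℤ_[p]} (h : (p : ℤ_[p]) ∣ u - v) (n : ℕ) :
    ‖u ^ p ^ n - v ^ p ^ n‖ ≤ (p : ℝ) ^ (-(n : ℤ)) := by
  rw [PadicInt.norm_le_pow_iff_mem_span_pow, Ideal.mem_span_singleton]
  exact (pow_dvd_pow _ n.le_succ).trans (dvd_sub_pow_of_dvd_sub h n)

lemma tendsto_pow_neg_zero : Tendsto (fun n : ℕ => (p : ℝ) ^ (-(n : ℤ))) atTop (𝓝 0) := by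
  have h : (1 : ℝ) < p := by exact_mod_cast (Fact.out : p.Prime).one_lt
  simpa [zpow_neg, ← inv_pow] using
    tendsto_pow_atTop_nhds_zero_of_lt_one (by positivity) (inv_lt_one_of_one_lt₀ h)

lemma dvd_pow_sub_self (u : ℤ_[p]) (n : ℕ) : (p : ℤ_[p]) ∣ u ^ p ^ n - u := by
  rw [← Ideal.mem_span_singleton, ← PadicInt.maximalIdeal_eq_span_p, ← PadicInt.ker_toZMod,
    RingHom.mem_ker, map_sub, map_pow, ZMod.pow_card_pow, sub_self]

lemma tendsto_teich {u : ℚ_[p]} (hu : ‖u‖ ≤ 1) :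
    Tendsto (fun n : ℕ => u ^ p ^ n) atTop (𝓝 (teich p u)) := by
  obtain ⟨u, rfl⟩ : ∃ w : ℤ_[p], (w : ℚ_[p]) = u := ⟨⟨u, hu⟩, rfl⟩
  refine tendsto_nhds_limUnder (cauchySeq_tendsto_of_complete ?_)
  refine NonarchimedeanAddGroup.cauchySeq_of_tendsto_sub_nhds_zero ?_
  refine squeeze_zero_norm (fun n => ?_) (tendsto_pow_neg_zero p)
  have h := norm_pow_pow_sub_le p (dvd_pow_sub_self p u 1) n
  rw [← pow_mul, ← pow_add, add_comm 1 n, PadicInt.norm_def] at h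
  exact_mod_cast h

lemma teich_mul {u v : ℚ_[p]} (hu : ‖u‖ ≤ 1) (hv : ‖v - 1‖ < 1) :
    teich p (u * v) = teich p u := by
  have hv1 : ‖v‖ ≤ 1 := by
    rw [← sub_add_cancel v 1]
    exact (Padic.nonarchimedean _ _).trans (max_le hv.le (by simp))
  obtain ⟨v, rfl⟩ : ∃ w : ℤ_[p], (w : ℚ_[p]) = v := ⟨⟨v, hv1⟩, rfl⟩
  have huv : ‖u * v‖ ≤ 1 := by
    rw [norm_mul]
    exact mul_le_one₀ hu (norm_nonneg _) hv1
  have h1 : Tendsto (fun n : ℕ => (v : ℚ_[p]) ^ p ^ n) atTop (𝓝 1) := by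
    rw [tendsto_iff_norm_sub_tendsto_zero]
    refine squeeze_zero (fun _ => norm_nonneg _) (fun n => ?_) (tendsto_pow_neg_zero p)
    have hd : (p : ℤ_[p]) ∣ v - 1 := by
      rw [← PadicInt.norm_lt_one_iff_dvd, PadicInt.norm_def]
      exact_mod_cast hv
    have h := norm_pow_pow_sub_le p hd n
    rw [one_pow, PadicInt.norm_def] at h
    exact_mod_cast h
  refine tendsto_nhds_unique (tendsto_teich p huv) ?_
  simpa [mul_pow] using (tendsto_teich p hu).mul h1

lemma norm_teich_sub_lt {u : ℚ_[p]} (hu : ‖u‖ ≤ 1) : ‖teich p u - u‖ < 1 := by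
  obtain ⟨u, rfl⟩ : ∃ w : ℤ_[p], (w : ℚ_[p]) = u := ⟨⟨u, hu⟩, rfl⟩
  have h : ‖teich p (u : ℚ_[p]) - u‖ ≤ (p : ℝ) ^ (-(1 : ℤ)) := by
    refine le_of_tendsto ((tendsto_teich p hu).sub_const (u : ℚ_[p])).norm (Eventually.of_forall fun n => ?_)
    have h := dvd_pow_sub_self p u n
    rw [← Ideal.mem_span_singleton, ← pow_one (p : ℤ_[p])] at h
    have h' := (PadicInt.norm_le_pow_iff_mem_span_pow _ 1).2 h
    rw [PadicInt.norm_def] at h'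
    exact_mod_cast h'
  refine h.trans_lt ?_
  rw [zpow_neg_one]
  exact inv_lt_one_of_one_lt₀ (by exact_mod_cast (Fact.out : p.Prime).one_lt)

lemma norm_teich {u : ℚ_[p]} (hu : ‖u‖ = 1) : ‖teich p u‖ = 1 := by
  rw [← hu]
  exact norm_eq_of_norm_sub_lt p (by simpa [hu] using norm_teich_sub_lt p hu.le)

lemma norm_angle_sub_one_lt {x : ℚ_[p]} (hx : x ≠ 0) : ‖angle p x - 1‖ < 1 := by
  have hu := norm_unitPart p hx
  have ht := norm_teich p hu
  have h0 : teich p (unitPart p x) ≠ 0 := norm_ne_zero_iff.1 (by simp [ht])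
  rw [angle, div_sub_one h0, norm_div, ht, div_one, norm_sub_rev]
  exact norm_teich_sub_lt p hu.le

lemma angle_ne_zero {x : ℚ_[p]} (hx : x ≠ 0) : angle p x ≠ 0 := by
  intro h
  simpa [h] using norm_angle_sub_one_lt p hx

lemma angle_mul {x v : ℚ_[p]} (hx : x ≠ 0) (hv : ‖v - 1‖ < 1) :
    angle p (x * v) = angle p x * v := by
  have hv1 : ‖v‖ = 1 := by
    rw [← norm_one (α := ℚ_[p])]
    exact norm_eq_of_norm_sub_lt p (by simpa using hv)
  have hv0 : v ≠ 0 := norm_ne_zero_iff.1 (by simp [hv1])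
  have hval : v.valuation = 0 := by
    have h := Padic.norm_eq_zpow_neg_valuation hv0
    rw [hv1, eq_comm, zpow_eq_one_iff_right₀ (by positivity)
      (by exact_mod_cast (Fact.out : p.Prime).ne_one)] at h
    omega
  have hu : unitPart p (x * v) = unitPart p x * v := by
    rw [unitPart, unitPart, Padic.valuation_mul hx hv0, hval, add_zero]
    ring
  rw [angle, angle, hu, teich_mul p (norm_unitPart p hx).le hv]
  ring

lemma norm_one_add_div_sub_one_lt {x h : ℚ_[p]} (hxh : ‖h‖ < ‖x‖) : ‖1 + h / x - 1‖ < 1 := by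
  rw [add_sub_cancel_left, norm_div]
  exact (div_lt_one ((norm_nonneg h).trans_lt hxh)).2 hxh

lemma angle_add {x h : ℚ_[p]} (hxh : ‖h‖ < ‖x‖) :
    angle p (x + h) = angle p x + h / omegaV p x := by
  have hx : x ≠ 0 := norm_pos_iff.1 ((norm_nonneg h).trans_lt hxh)
  have h1 := angle_mul p hx (norm_one_add_div_sub_one_lt p hxh)
  rw [mul_add, mul_one, mul_div_cancel₀ _ hx] at h1
  rw [h1, omegaV]
  field_simp

lemma omegaV_add {x h : ℚ_[p]} (hxh : ‖h‖ < ‖x‖) : omegaV p (x + h) = omegaV p x := by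
  have hx : x ≠ 0 := norm_pos_iff.1 ((norm_nonneg h).trans_lt hxh)
  have hv := norm_one_add_div_sub_one_lt p hxh
  have hv0 : 1 + h / x ≠ 0 := by
    intro h0
    simp [h0] at hv
  have e : x + h = x * (1 + h / x) := by field_simp
  rw [omegaV, omegaV, e, angle_mul p hx hv, mul_div_mul_right _ _ hv0]

lemma norm_omegaV {x : ℚ_[p]} (hx : x ≠ 0) : ‖omegaV p x‖ = ‖x‖ := by
  have h : ‖angle p x‖ = 1 := by
    rw [← norm_one (α := ℚ_[p])]
    exact norm_eq_of_norm_sub_lt p (by simpa using norm_angle_sub_one_lt p hx)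
  rw [omegaV, norm_div, h, div_one]

end Angle

section Zeta

variable (p : ℕ) [Fact p.Prime]

lemma norm_add_coe_eq {lam : ℚ_[p]} (hlam : 1 < ‖lam‖) (x : ℤ_[p]) :
    ‖lam + (x : ℚ_[p])‖ = ‖lam‖ := by
  have h : ‖(x : ℚ_[p])‖ < ‖lam‖ := x.norm_le_one.trans_lt hlam
  rw [Padic.add_eq_max_of_ne h.ne', max_eq_left h.le]

lemma tendsto_fermSum_zetaE (hp : Odd p) {f : ℤ_[p] → ℤ_[p]} (hf : Continuous f) (s : ℤ_[p])
    {lam : ℚ_[p]} (hlam : 1 < ‖lam‖) :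
    Tendsto (fermSum p fun a => bpow p (angle p (lam + (f a : ℚ_[p]))) (1 - (s : ℚ_[p])))
      atTop (𝓝 (zetaE p f s lam)) := by
  refine tendsto_nhds_limUnder (exists_tendsto_fermSum p hp ?_)
  have hlt (a) : ‖(f a : ℚ_[p])‖ < ‖lam‖ := (f a).norm_le_one.trans_lt hlam
  have hne (a) : lam + (f a : ℚ_[p]) ≠ 0 :=
    norm_pos_iff.1 (by rw [norm_add_coe_eq p hlam]; linarith)
  have hc : Continuous fun a => angle p (lam + (f a : ℚ_[p])) := by
    simp only [fun a => angle_add p (hlt a)]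
    fun_prop
  rw [continuous_iff_continuousAt]
  intro a
  have h := continuousAt_bpow p (1 - s) (norm_angle_sub_one_lt p (hne a))
  push_cast at h
  exact ContinuousAt.comp (f := fun a => angle p (lam + (f a : ℚ_[p]))) h hc.continuousAt

/-- Uniform Taylor estimate for the integrand of `zetaE`, integrated. -/
lemma norm_zetaE_add_sub_le (hp : Odd p) {f : ℤ_[p] → ℤ_[p]} (hf : Continuous f) (s : ℤ_[p])
    {lam h : ℚ_[p]} (hlam : 1 < ‖lam‖) (hh : ‖h‖ < ‖lam‖) :
    ‖zetaE p f s (lam + h) - zetaE p f s lam -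
      h * ((omegaV p lam)⁻¹ * ((1 - s) * zetaE p f (s + 1) lam))‖ ≤ ‖h‖ ^ 2 := by
  have hlam' : 1 < ‖lam + h‖ := by
    rwa [Padic.add_eq_max_of_ne hh.ne', max_eq_left hh.le]
  have T := ((tendsto_fermSum_zetaE p hp hf s hlam').sub (tendsto_fermSum_zetaE p hp hf s hlam)).sub
    ((((tendsto_fermSum_zetaE p hp hf (s + 1) hlam).const_mul (1 - (s : ℚ_[p]))).const_mul
      (omegaV p lam)⁻¹).const_mul h)
  refine le_of_tendsto T.norm (Eventually.of_forall fun N => ?_)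
  have e : ∀ a b c : ℤ_[p] → ℚ_[p], ∀ d : ℚ_[p],
      fermSum p a N - fermSum p b N - d * fermSum p c N =
        fermSum p (fun x => a x - b x - d * c x) N := by
    intro a b c d
    simp only [fermSum, Finset.mul_sum, ← Finset.sum_sub_distrib]
    exact Finset.sum_congr rfl fun x _ => by ring
  rw [← mul_assoc, ← mul_assoc, e]
  refine norm_fermSum_le p (by positivity) (fun a => ?_) N
  set x := lam + (f a : ℚ_[p]) with hx
  have hxn : ‖x‖ = ‖lam‖ := norm_add_coe_eq p hlam (f a)
  have hx0 : x ≠ 0 := norm_pos_iff.1 (by rw [hxn]; linarith)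
  have hω : omegaV p x = omegaV p lam := omegaV_add p ((f a).norm_le_one.trans_lt hlam)
  have hωn : ‖omegaV p lam‖ = ‖lam‖ := norm_omegaV p (norm_pos_iff.1 (by linarith))
  have hk : ‖h / omegaV p lam‖ < 1 := by
    rw [norm_div, hωn]
    exact (div_lt_one (by linarith)).2 hh
  have hk' : ‖h / omegaV p lam‖ ≤ ‖h‖ := by
    rw [norm_div, hωn]
    exact div_le_self (norm_nonneg _) hlam.le
  have B := norm_bpow_add_sub_le p (1 - s) (norm_angle_sub_one_lt p hx0) hk
  rw [← hω, ← angle_add p (hxn ▸ hh), hω] at B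
  push_cast at B ⊢
  have e1 : lam + h + (f a : ℚ_[p]) = x + h := by rw [hx]; ring
  have e2 : (1 : ℚ_[p]) - (s + 1) = 1 - s - 1 := by ring
  rw [e1, e2]
  refine le_trans (le_of_eq ?_) (B.trans (pow_le_pow_left₀ (norm_nonneg _) hk' 2))
  congr 1
  rw [div_eq_mul_inv]
  ring

lemma hasDerivAt_zetaE (hp : Odd p) {f : ℤ_[p] → ℤ_[p]} (hf : Continuous f) (s : ℤ_[p])
    {lam : ℚ_[p]} (hlam : 1 < ‖lam‖) :
    HasDerivAt (fun mu => zetaE p f s mu)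
      ((omegaV p lam)⁻¹ * ((1 - s) * zetaE p f (s + 1) lam)) lam := by
  rw [hasDerivAt_iff_isLittleO_nhds_zero]
  refine Asymptotics.IsBigO.trans_isLittleO (g := fun h : ℚ_[p] => h ^ 2) ?_
    (by simpa using Asymptotics.isLittleO_pow_pow (𝕜 := ℚ_[p]) one_lt_two)
  refine Asymptotics.IsBigO.of_bound 1 ?_
  filter_upwards [Metric.ball_mem_nhds (0 : ℚ_[p]) (zero_lt_one.trans hlam)] with h hh
  rw [one_mul, norm_pow, smul_eq_mul]
  exact norm_zetaE_add_sub_le p hp hf s hlam (by simpa using hh)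

lemma eventually_omegaV_eq {lam : ℚ_[p]} (hlam : lam ≠ 0) :
    ∀ᶠ mu in 𝓝 lam, omegaV p mu = omegaV p lam := by
  filter_upwards [Metric.ball_mem_nhds lam (norm_pos_iff.2 hlam)] with mu hmu
  rw [Metric.mem_ball, dist_eq_norm] at hmu
  simpa using omegaV_add p hmu

/-- The right-hand side of the `n`-th derivative formula, differentiated once more. -/
lemma hasDerivAt_pochhammer_mul_zetaE (hp : Odd p) {f : ℤ_[p] → ℤ_[p]} (hf : Continuous f)
    (s : ℤ_[p]) (n : ℕ) {lam : ℚ_[p]} (hlam : 1 < ‖lam‖) :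
    HasDerivAt (fun mu => (-1 : ℚ_[p]) ^ n * (∏ i ∈ Finset.range n, ((s : ℚ_[p]) - 1 + (i : ℚ_[p]))) *
        ((omegaV p mu) ^ n)⁻¹ * zetaE p f (s + (n : ℤ_[p])) mu)
      ((-1 : ℚ_[p]) ^ (n + 1) *
        (∏ i ∈ Finset.range (n + 1), ((s : ℚ_[p]) - 1 + (i : ℚ_[p]))) *
        ((omegaV p lam) ^ (n + 1))⁻¹ * zetaE p f (s + ((n + 1 : ℕ) : ℤ_[p])) lam) lam := by
  have hlam0 : lam ≠ 0 := norm_pos_iff.1 (by linarith)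
  have h := (hasDerivAt_zetaE p hp hf (s + (n : ℤ_[p])) hlam).const_mul
    ((-1 : ℚ_[p]) ^ n * (∏ i ∈ Finset.range n, ((s : ℚ_[p]) - 1 + (i : ℚ_[p]))) *
        ((omegaV p lam) ^ n)⁻¹)
  refine (h.congr_of_eventuallyEq ?_).congr_deriv ?_
  · filter_upwards [eventually_omegaV_eq p hlam0] with mu hmu
    rw [hmu]
  · rw [Finset.prod_range_succ, pow_succ (omegaV p lam), mul_inv]
    push_cast
    rw [← add_assoc]
    ring

lemma iteratedDeriv_zetaE (hp : Odd p) {f : ℤ_[p] → ℤ_[p]} (hf : Continuous f)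
    (s : ℤ_[p]) (n : ℕ) {lam : ℚ_[p]} (hlam : 1 < ‖lam‖) :
    iteratedDeriv n (fun mu : ℚ_[p] => zetaE p f s mu) lam =
      (-1 : ℚ_[p]) ^ n * (∏ i ∈ Finset.range n, ((s : ℚ_[p]) - 1 + (i : ℚ_[p]))) *
        ((omegaV p lam) ^ n)⁻¹ * zetaE p f (s + (n : ℤ_[p])) lam := by
  induction n generalizing lam with
  | zero => simp
  | succ n ih =>
    rw [iteratedDeriv_succ]
    refine ((hasDerivAt_pochhammer_mul_zetaE p hp hf s n hlam).congr_of_eventuallyEq ?_).deriv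
    filter_upwards [(isOpen_lt continuous_const continuous_norm).mem_nhds hlam] with mu hmu
    exact ih hmu

end Zeta

end PZeta

/-- on `U = {λ : ‖λ‖ > 1}` the function `λ ↦ ζ_{p,E}^f(s,λ)` is `n` times
differentiable, the defining fermionic integrals for `ζ_{p,E}^f(s+k,λ)` (`k ≤ n`) exist, and
`(∂/∂λ)^n ζ_{p,E}^f(s,λ) = (-1)^n (s-1)_n ω_v(λ)^{-n} ζ_{p,E}^f(s+n,λ)`, where
`(a)_n = a(a+1)⋯(a+n-1)` is the Pochhammer symbol. -/
theorem zetaE_derivative_formula (p : ℕ) [Fact p.Prime] (hp : Odd p)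
    (f : ℤ_[p] → ℤ_[p]) (hf : Continuous f) (s : ℤ_[p]) (n : ℕ) :
    (∀ lam : ℚ_[p], 1 < ‖lam‖ → ∀ k : ℕ, k ≤ n →
      Filter.Tendsto
        (fermSum p fun a =>
          bpow p (angle p (lam + (f a : ℚ_[p]))) (1 - ((s + (k : ℤ_[p]) : ℤ_[p]) : ℚ_[p])))
        Filter.atTop (nhds (zetaE p f (s + (k : ℤ_[p])) lam))) ∧
    (∀ k : ℕ, k < n → ∀ lam : ℚ_[p], 1 < ‖lam‖ →
      DifferentiableAt ℚ_[p] (iteratedDeriv k (fun mu : ℚ_[p] => zetaE p f s mu)) lam) ∧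
    (∀ lam : ℚ_[p], 1 < ‖lam‖ →
      iteratedDeriv n (fun mu : ℚ_[p] => zetaE p f s mu) lam =
        (-1 : ℚ_[p]) ^ n * (∏ i ∈ Finset.range n, ((s : ℚ_[p]) - 1 + (i : ℚ_[p]))) *
          ((omegaV p lam) ^ n)⁻¹ * zetaE p f (s + (n : ℤ_[p])) lam) := by
  refine ⟨fun lam hlam k _ => tendsto_fermSum_zetaE p hp hf _ hlam, fun k _ lam hlam => ?_,
    fun lam hlam => iteratedDeriv_zetaE p hp hf s n hlam⟩
  refine ((hasDerivAt_pochhammer_mul_zetaE p hp hf s k hlam).congr_of_eventuallyEq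
    ?_).differentiableAt
  filter_upwards [(isOpen_lt continuous_const continuous_norm).mem_nhds hlam] with mu hmu
  exact iteratedDeriv_zetaE p hp hf s k hmu
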